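/- Let n be an integer with 1 ≤ n ≤ 200 and let α satisfy 0.0001 < α < 0.27. Let 0 < u_0 < ⋯ < u_n = 1 be OLC upper endpoints at level 1−α, and let 0 < v_0 < ⋯ < v_n = 1 be any sequence giving upper-tail LCC intervals at level 1−α. Then the average expected length of the OLC intervals is no larger than that of the other estimator: ∫_0^1 Σ_{x=0}^n u_x B(n,x,p) dp ≤ ∫_0^1 Σ_{x=0}^n v_x B(n,x,p) dp. -/

import Mathlib

open MeasureTheory

/-- The binomial probability mass function: `B n x p = C(n,x) p^x (1-p)^(n-x)`. -/
noncomputable def B (n x : ℕ) (p : ℝ) : ℝ :=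
  (n.choose x : ℝ) * p ^ x * (1 - p) ^ (n - x)

/-- A sequence `0 < u 0 < u 1 < ⋯ < u n = 1` of OLC upper endpoints at level `1 - α`:
each inter-spike average coverage equals the nominal level. -/
def IsOLCUpper (n : ℕ) (α : ℝ) (u : ℕ → ℝ) : Prop :=
  0 < u 0 ∧ (∀ i, i < n → u i < u (i + 1)) ∧ u n = 1 ∧
    ∀ i, 1 ≤ i → i ≤ n →
      (∫ p in (u (i - 1))..(u i), ∑ x ∈ Finset.Icc i n, B n x p)
        = (1 - α) * (u i - u (i - 1))

/-- A sequence `0 < v 0 < v 1 < ⋯ < v n = 1` giving upper-tail locally correct confidence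
(LCC) intervals at level `1 - α`: each inter-spike average coverage is at least the
nominal level. -/
def IsLCCUpper (n : ℕ) (α : ℝ) (v : ℕ → ℝ) : Prop :=
  0 < v 0 ∧ (∀ i, i < n → v i < v (i + 1)) ∧ v n = 1 ∧
    ∀ i, 1 ≤ i → i ≤ n →
      (1 - α) * (v i - v (i - 1))
        ≤ ∫ p in (v (i - 1))..(v i), ∑ x ∈ Finset.Icc i n, B n x p

/-- A sequence `0 = l 0 < l 1 < ⋯ < l n < 1` of OLC lower endpoints at level `1 - α`. -/
def IsOLCLower (n : ℕ) (α : ℝ) (l : ℕ → ℝ) : Prop :=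
  l 0 = 0 ∧ (∀ i, i < n → l i < l (i + 1)) ∧ l n < 1 ∧
    ∀ i, i < n →
      (∫ p in (l i)..(l (i + 1)), ∑ x ∈ Finset.range (i + 1), B n x p)
        = (1 - α) * (l (i + 1) - l i)

/-- A sequence `0 = l 0 < l 1 < ⋯ < l n < 1` giving lower-tail LCC intervals at level
`1 - α`. -/
def IsLCCLower (n : ℕ) (α : ℝ) (l : ℕ → ℝ) : Prop :=
  l 0 = 0 ∧ (∀ i, i < n → l i < l (i + 1)) ∧ l n < 1 ∧
    ∀ i, i < n →
      (1 - α) * (l (i + 1) - l i)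
        ≤ ∫ p in (l i)..(l (i + 1)), ∑ x ∈ Finset.range (i + 1), B n x p

/-- The logarithm of the ratio of `p ^ d * (1 - p) ^ k` at the two points `M + t`, `M - t`. -/
noncomputable def logReflectRatio (d k : ℕ) (M t : ℝ) : ℝ :=
  d * (Real.log (M + t) - Real.log (M - t)) -
    k * (Real.log (1 - M + t) - Real.log (1 - M - t))

theorem hasDerivAt_logReflectRatio (d k : ℕ) {M t : ℝ} (ht0 : 0 ≤ t) (ht1 : t < M)
    (ht2 : t < 1 - M) :
    HasDerivAt (logReflectRatio d k M)
      (2 * (d * M * ((1 - M) ^ 2 - t ^ 2) - k * (1 - M) * (M ^ 2 - t ^ 2)) /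
        ((M ^ 2 - t ^ 2) * ((1 - M) ^ 2 - t ^ 2))) t := by
  have e1 : M + t ≠ 0 := by linarith
  have e2 : M - t ≠ 0 := by linarith
  have e3 : 1 - M + t ≠ 0 := by linarith
  have e4 : 1 - M - t ≠ 0 := by linarith
  have h1 := (((hasDerivAt_id t).const_add M).log e1)
  have h2 := (((hasDerivAt_id t).const_sub M).log e2)
  have h3 := (((hasDerivAt_id t).const_add (1 - M)).log e3)
  have h4 := (((hasDerivAt_id t).const_sub (1 - M)).log e4)
  have h := ((h1.sub h2).const_mul (d : ℝ)).sub ((h3.sub h4).const_mul (k : ℝ))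
  refine h.congr_deriv ?_
  have e5 : (M ^ 2 - t ^ 2) ≠ 0 := by
    rw [sq_sub_sq]; exact mul_ne_zero e1 e2
  have e6 : ((1 - M) ^ 2 - t ^ 2) ≠ 0 := by
    rw [sq_sub_sq]; exact mul_ne_zero e3 e4
  simp only [id]
  rw [sq_sub_sq, sq_sub_sq]
  field_simp
  ring

theorem logReflectRatio_zero (d k : ℕ) (M : ℝ) : logReflectRatio d k M 0 = 0 := by
  simp [logReflectRatio]

theorem logReflectRatio_swap (d k : ℕ) (M t : ℝ) :
    logReflectRatio k d (1 - M) t = -logReflectRatio d k M t := by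
  simp only [logReflectRatio, sub_sub_cancel]
  ring

theorem logReflectRatio_eq (d k : ℕ) {M t : ℝ} (ht0 : 0 ≤ t) (ht1 : t < M)
    (ht2 : t < 1 - M) :
    logReflectRatio d k M t = Real.log ((M + t) ^ d * (1 - (M + t)) ^ k) -
      Real.log ((M - t) ^ d * (1 - (M - t)) ^ k) := by
  have e1 : 0 < M + t := by linarith
  have e2 : 0 < M - t := by linarith
  have e3 : 0 < 1 - (M - t) := by linarith
  have e4 : 0 < 1 - (M + t) := by linarith
  rw [Real.log_mul (by positivity) (by positivity), Real.log_mul (by positivity) (by positivity)]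
  simp only [Real.log_pow, logReflectRatio]
  rw [show 1 - M + t = 1 - (M - t) by ring, show 1 - M - t = 1 - (M + t) by ring]
  ring

theorem logReflectRatio_pos_iff (d k : ℕ) {M t : ℝ} (ht0 : 0 ≤ t) (ht1 : t < M)
    (ht2 : t < 1 - M) :
    0 < logReflectRatio d k M t ↔
      (M - t) ^ d * (1 - (M - t)) ^ k < (M + t) ^ d * (1 - (M + t)) ^ k := by
  have e1 : 0 < M + t := by linarith
  have e2 : 0 < M - t := by linarith
  have e3 : 0 < 1 - (M - t) := by linarith
  have e4 : 0 < 1 - (M + t) := by linarith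
  rw [logReflectRatio_eq d k ht0 ht1 ht2, sub_pos, Real.log_lt_log_iff] <;> positivity

/-- If `M` lies to the right of the mode of `p ^ d * (1 - p) ^ k`, then the ratio of the density
at `M + t` to that at `M - t` stays above `1` once it exceeds `1`. -/
theorem logReflectRatio_pos_of_le (d k : ℕ) {M t₁ t₂ : ℝ} (hM : d * (1 - M) ≤ k * M)
    (h0 : 0 < t₁) (h12 : t₁ ≤ t₂) (ht1 : t₂ < M) (ht2 : t₂ < 1 - M)
    (hpos : 0 < logReflectRatio d k M t₁) : 0 < logReflectRatio d k M t₂ := by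
  have hd : ∀ t, 0 ≤ t → t ≤ t₂ → HasDerivAt (logReflectRatio d k M)
      (2 * (d * M * ((1 - M) ^ 2 - t ^ 2) - k * (1 - M) * (M ^ 2 - t ^ 2)) /
        ((M ^ 2 - t ^ 2) * ((1 - M) ^ 2 - t ^ 2))) t := fun t ha hb =>
    hasDerivAt_logReflectRatio d k ha (hb.trans_lt ht1) (hb.trans_lt ht2)
  have hden : ∀ t, 0 ≤ t → t ≤ t₂ → 0 < (M ^ 2 - t ^ 2) * ((1 - M) ^ 2 - t ^ 2) := by
    intro t ha hb
    have : 0 < M ^ 2 - t ^ 2 := by rw [sq_sub_sq]; apply mul_pos <;> linarith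
    have : 0 < (1 - M) ^ 2 - t ^ 2 := by rw [sq_sub_sq]; apply mul_pos <;> linarith
    positivity
  obtain ⟨ξ, hξ, hξe⟩ := exists_hasDerivAt_eq_slope (logReflectRatio d k M) _ h0
    (fun t ht => (hd t ht.1 (ht.2.trans h12)).continuousAt.continuousWithinAt)
    (fun t ht => hd t ht.1.le (ht.2.le.trans h12))
  rw [logReflectRatio_zero, sub_zero, sub_zero] at hξe
  have hξp : 0 < logReflectRatio d k M t₁ / t₁ := by positivity
  rw [← hξe] at hξp
  have hnum : 0 < d * M * ((1 - M) ^ 2 - ξ ^ 2) - k * (1 - M) * (M ^ 2 - ξ ^ 2) := by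
    have := (div_pos_iff_of_pos_right (hden ξ hξ.1.le (hξ.2.le.trans h12))).1 hξp
    linarith
  have hM0 : 0 < M := by linarith
  have hM1 : 0 < 1 - M := by linarith
  have hslope : 0 < k * (1 - M) - d * M := by
    have h3 : M * (1 - M) * (d * (1 - M) - k * M) ≤ 0 :=
      mul_nonpos_of_nonneg_of_nonpos (by positivity) (by linarith)
    have h4 : 0 < ξ ^ 2 * (k * (1 - M) - d * M) := by nlinarith
    exact pos_of_mul_pos_right h4 (by positivity)
  have hmono : MonotoneOn (logReflectRatio d k M) (Set.Icc t₁ t₂) := by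
    apply monotoneOn_of_hasDerivWithinAt_nonneg (convex_Icc _ _)
      (fun t ht => (hd t (h0.le.trans ht.1) ht.2).continuousAt.continuousWithinAt)
      (fun t ht => (hd t (h0.le.trans (interior_subset ht).1)
        (interior_subset ht).2).hasDerivWithinAt)
    intro t ht
    replace ht := interior_subset ht
    have hξt : ξ ^ 2 ≤ t ^ 2 := by
      apply pow_le_pow_left₀ hξ.1.le; linarith [hξ.2, ht.1]
    have := hden t (h0.le.trans ht.1) ht.2
    apply div_nonneg _ this.le
    nlinarith
  exact hpos.trans_le (hmono (Set.left_mem_Icc.2 h12) (Set.right_mem_Icc.2 h12) h12)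

/-- If `M ≥ 1 / 2` lies to the right of the mode, then the density at `M + t` never exceeds the
density at `M - t`. -/
theorem logReflectRatio_nonpos (d k : ℕ) {M t : ℝ} (hM : d * (1 - M) ≤ k * M)
    (hM2 : 1 / 2 ≤ M) (ht0 : 0 ≤ t) (ht2 : t < 1 - M) : logReflectRatio d k M t ≤ 0 := by
  have hd : ∀ s, 0 ≤ s → s ≤ t → HasDerivAt (logReflectRatio d k M)
      (2 * (d * M * ((1 - M) ^ 2 - s ^ 2) - k * (1 - M) * (M ^ 2 - s ^ 2)) /
        ((M ^ 2 - s ^ 2) * ((1 - M) ^ 2 - s ^ 2))) s := fun s ha hb =>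
    hasDerivAt_logReflectRatio d k ha (by linarith) (by linarith)
  have hanti : AntitoneOn (logReflectRatio d k M) (Set.Icc 0 t) := by
    apply antitoneOn_of_hasDerivWithinAt_nonpos (convex_Icc _ _)
      (fun s hs => (hd s hs.1 hs.2).continuousAt.continuousWithinAt)
      (fun s hs => (hd s (interior_subset hs).1 (interior_subset hs).2).hasDerivWithinAt)
    intro s hs
    replace hs := interior_subset hs
    have h1 : 0 < M ^ 2 - s ^ 2 := by rw [sq_sub_sq]; apply mul_pos <;> linarith [hs.1, hs.2]
    have h2 : 0 < (1 - M) ^ 2 - s ^ 2 := by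
      rw [sq_sub_sq]; apply mul_pos <;> linarith [hs.1, hs.2]
    apply div_nonpos_of_nonpos_of_nonneg _ (by positivity)
    have hM1 : 0 < 1 - M := by linarith
    have h3 : (d * (1 - M)) * (M * ((1 - M) ^ 2 - s ^ 2)) ≤
        (k * M) * (M * ((1 - M) ^ 2 - s ^ 2)) :=
      mul_le_mul_of_nonneg_right hM (by positivity)
    have h4 : 0 ≤ (k : ℝ) * (s ^ 2 * (2 * M - 1)) := by
      have : 0 ≤ 2 * M - 1 := by linarith
      positivity
    have h5 : (1 - M) * (d * M * ((1 - M) ^ 2 - s ^ 2) - k * (1 - M) * (M ^ 2 - s ^ 2)) ≤ 0 := by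
      nlinarith
    nlinarith [nonpos_of_mul_nonpos_right h5 hM1]
  have := hanti (Set.left_mem_Icc.2 ht0) (Set.right_mem_Icc.2 ht0) ht0
  rwa [logReflectRatio_zero] at this

section tail

variable {Q P : ℝ → ℝ} {C α M : ℝ} {d k : ℕ}

theorem strictAntiOn_of_tail (hC : 0 < C)
    (hQ : ∀ p, HasDerivAt Q (-(C * (p ^ d * (1 - p) ^ k))) p) :
    StrictAntiOn Q (Set.Icc 0 1) := by
  apply strictAntiOn_of_hasDerivWithinAt_neg (convex_Icc _ _)
    (fun p _ => (hQ p).continuousAt.continuousWithinAt)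
    (fun p _ => (hQ p).hasDerivWithinAt)
  intro p hp
  rw [interior_Icc] at hp
  have h1 : 0 < p := hp.1
  have h2 : 0 < 1 - p := by linarith [hp.2]
  have : 0 < C * (p ^ d * (1 - p) ^ k) := by positivity
  linarith

theorem hasDerivAt_reflect_add (hQ : ∀ p, HasDerivAt Q (-(C * (p ^ d * (1 - p) ^ k))) p)
    (M t : ℝ) :
    HasDerivAt (fun t => Q (M - t) + Q (M + t))
      (C * ((M - t) ^ d * (1 - (M - t)) ^ k - (M + t) ^ d * (1 - (M + t)) ^ k)) t := by
  have h1 := (hQ (M - t)).comp t ((hasDerivAt_id t).const_sub M)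
  have h2 := (hQ (M + t)).comp t ((hasDerivAt_id t).const_add M)
  refine (h1.add h2).congr_deriv ?_
  ring

theorem continuous_reflect_add (hQ : ∀ p, HasDerivAt Q (-(C * (p ^ d * (1 - p) ^ k))) p)
    (M : ℝ) : Continuous (fun t => Q (M - t) + Q (M + t)) :=
  continuous_iff_continuousAt.2 fun t => (hasDerivAt_reflect_add hQ M t).continuousAt

theorem hasDerivAt_reflect_sub (hP : ∀ p, HasDerivAt P (Q p) p) (M t : ℝ) :
    HasDerivAt (fun t => P (M + t) - P (M - t)) (Q (M - t) + Q (M + t)) t := by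
  have h1 := (hP (M - t)).comp t ((hasDerivAt_id t).const_sub M)
  have h2 := (hP (M + t)).comp t ((hasDerivAt_id t).const_add M)
  refine (h2.sub h1).congr_deriv ?_
  ring

theorem exists_reflect_add_eq (hP : ∀ p, HasDerivAt P (Q p) p) (M : ℝ) {a b : ℝ} (hab : a < b) :
    ∃ ξ ∈ Set.Ioo a b, (P (M + b) - P (M - b)) - (P (M + a) - P (M - a)) =
      (Q (M - ξ) + Q (M + ξ)) * (b - a) := by
  obtain ⟨ξ, hξ, h⟩ := exists_hasDerivAt_eq_slope (fun t => P (M + t) - P (M - t)) _ hab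
    (fun t _ => (hasDerivAt_reflect_sub hP M t).continuousAt.continuousWithinAt)
    (fun t _ => hasDerivAt_reflect_sub hP M t)
  refine ⟨ξ, hξ, ?_⟩
  rw [h, div_mul_cancel₀ _ (by linarith)]

theorem monotoneOn_reflect_add (hC : 0 < C)
    (hQ : ∀ p, HasDerivAt Q (-(C * (p ^ d * (1 - p) ^ k))) p)
    (hM : d * (1 - M) ≤ k * M) (hM2 : 1 / 2 ≤ M) :
    MonotoneOn (fun t => Q (M - t) + Q (M + t)) (Set.Icc 0 (1 - M)) := by
  apply monotoneOn_of_hasDerivWithinAt_nonneg (convex_Icc _ _)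
    (continuous_reflect_add hQ M).continuousOn
    (fun t _ => (hasDerivAt_reflect_add hQ M t).hasDerivWithinAt)
  intro t ht
  rw [interior_Icc] at ht
  have h := logReflectRatio_nonpos d k hM hM2 ht.1.le ht.2
  have h' := mt (logReflectRatio_pos_iff d k ht.1.le (by linarith [ht.2]) ht.2).2 (not_lt.2 h)
  have := not_lt.1 h'
  exact mul_nonneg hC.le (by linarith)

theorem antitoneOn_reflect_add (hC : 0 < C)
    (hQ : ∀ p, HasDerivAt Q (-(C * (p ^ d * (1 - p) ^ k))) p)
    (hM : k * M ≤ d * (1 - M)) (hM2 : M ≤ 1 / 2) :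
    AntitoneOn (fun t => Q (M - t) + Q (M + t)) (Set.Icc 0 M) := by
  apply antitoneOn_of_hasDerivWithinAt_nonpos (convex_Icc _ _)
    (continuous_reflect_add hQ M).continuousOn
    (fun t _ => (hasDerivAt_reflect_add hQ M t).hasDerivWithinAt)
  intro t ht
  rw [interior_Icc] at ht
  have h := logReflectRatio_nonpos k d (M := 1 - M) (by simpa using hM) (by linarith) ht.1.le
    (by linarith [ht.2])
  rw [logReflectRatio_swap, logReflectRatio_eq d k ht.1.le ht.2 (by linarith [ht.2])] at h
  have e1 : 0 < M + t := by linarith [ht.1, ht.2]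
  have e2 : 0 < M - t := by linarith [ht.1, ht.2]
  have e3 : 0 < 1 - (M - t) := by linarith [ht.1, ht.2]
  have e4 : 0 < 1 - (M + t) := by linarith [ht.1, ht.2]
  have := (Real.log_le_log_iff (x := (M - t) ^ d * (1 - (M - t)) ^ k)
    (y := (M + t) ^ d * (1 - (M + t)) ^ k) (by positivity) (by positivity)).1 (by linarith)
  exact mul_nonpos_of_nonneg_of_nonpos hC.le (by linarith)

/-- To the right of the mode, `t ↦ Q (M - t) + Q (M + t)` first increases and then decreases. -/
theorem min_le_reflect_add (hC : 0 < C)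
    (hQ : ∀ p, HasDerivAt Q (-(C * (p ^ d * (1 - p) ^ k))) p)
    (hM : d * (1 - M) ≤ k * M) (hM2 : M ≤ 1 / 2) {ξ t : ℝ} (h0 : 0 < ξ) (hξt : ξ < t)
    (htM : t < M) :
    min (Q (M - ξ) + Q (M + ξ)) (Q (M - M) + Q (M + M)) ≤ Q (M - t) + Q (M + t) := by
  by_contra! hlt
  obtain ⟨hlt1, hlt2⟩ := lt_min_iff.1 hlt
  obtain ⟨η, hη, hηe⟩ := exists_hasDerivAt_eq_slope (fun t => Q (M - t) + Q (M + t)) _ hξt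
    (continuous_reflect_add hQ M).continuousOn (fun t _ => hasDerivAt_reflect_add hQ M t)
  have hneg : C * ((M - η) ^ d * (1 - (M - η)) ^ k - (M + η) ^ d * (1 - (M + η)) ^ k) < 0 := by
    rw [hηe]
    exact div_neg_of_neg_of_pos (by linarith) (by linarith)
  have hη0 : 0 < η := h0.trans hη.1
  have hηM : η < M := hη.2.trans htM
  have hℓ : 0 < logReflectRatio d k M η := by
    rw [logReflectRatio_pos_iff d k hη0.le hηM (by linarith)]
    have := neg_of_mul_neg_right hneg hC.le
    linarith
  have hanti : AntitoneOn (fun t => Q (M - t) + Q (M + t)) (Set.Icc η M) := by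
    apply antitoneOn_of_hasDerivWithinAt_nonpos (convex_Icc _ _)
      (continuous_reflect_add hQ M).continuousOn
      (fun t _ => (hasDerivAt_reflect_add hQ M t).hasDerivWithinAt)
    intro s hs
    rw [interior_Icc] at hs
    have h := logReflectRatio_pos_of_le d k hM hη0 hs.1.le hs.2 (by linarith [hs.2]) hℓ
    rw [logReflectRatio_pos_iff d k (by linarith [hs.1]) hs.2 (by linarith [hs.2])] at h
    exact mul_nonpos_of_nonneg_of_nonpos hC.le (by linarith)
  have := hanti ⟨hη.2.le, htM.le⟩ (Set.right_mem_Icc.2 hηM.le) htM.le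
  simp only at this
  linarith

/-- To the left of the mode, `t ↦ Q (M - t) + Q (M + t)` first decreases and then increases. -/
theorem monotoneOn_reflect_add_of_lt (hC : 0 < C)
    (hQ : ∀ p, HasDerivAt Q (-(C * (p ^ d * (1 - p) ^ k))) p)
    (hM : k * M ≤ d * (1 - M)) (hM2 : 1 / 2 ≤ M) {ξ a : ℝ} (h0 : 0 < ξ) (hξa : ξ < a)
    (haM : a < 1 - M) (hlt : Q (M - ξ) + Q (M + ξ) < Q (M - a) + Q (M + a)) :
    MonotoneOn (fun t => Q (M - t) + Q (M + t)) (Set.Icc a (1 - M)) := by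
  obtain ⟨η, hη, hηe⟩ := exists_hasDerivAt_eq_slope (fun t => Q (M - t) + Q (M + t)) _ hξa
    (continuous_reflect_add hQ M).continuousOn (fun t _ => hasDerivAt_reflect_add hQ M t)
  have hpos : 0 < C * ((M - η) ^ d * (1 - (M - η)) ^ k - (M + η) ^ d * (1 - (M + η)) ^ k) := by
    rw [hηe]
    exact div_pos (by linarith) (by linarith)
  have hη0 : 0 < η := h0.trans hη.1
  have hηM : η < 1 - M := hη.2.trans haM
  have key : ∀ s, 0 ≤ s → s < 1 - M → (0 < logReflectRatio k d (1 - M) s ↔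
      (M + s) ^ d * (1 - (M + s)) ^ k < (M - s) ^ d * (1 - (M - s)) ^ k) := by
    intro s hs0 hs
    rw [logReflectRatio_pos_iff k d hs0 hs (by linarith)]
    rw [show 1 - (1 - M - s) = M + s by ring, show 1 - (1 - M + s) = M - s by ring,
      show 1 - M - s = 1 - (M + s) by ring, show 1 - M + s = 1 - (M - s) by ring,
      mul_comm ((1 - (M + s)) ^ k), mul_comm ((1 - (M - s)) ^ k)]
  have hℓ : 0 < logReflectRatio k d (1 - M) η := by
    rw [key η hη0.le hηM]
    have := pos_of_mul_pos_right hpos hC.le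
    linarith
  apply monotoneOn_of_hasDerivWithinAt_nonneg (convex_Icc _ _)
    (continuous_reflect_add hQ M).continuousOn
    (fun t _ => (hasDerivAt_reflect_add hQ M t).hasDerivWithinAt)
  intro s hs
  rw [interior_Icc] at hs
  have h := logReflectRatio_pos_of_le k d (M := 1 - M) (t₂ := s) (by simpa using hM) hη0
    (by linarith [hs.1, hη.2]) hs.2 (by linarith [hs.2]) hℓ
  rw [key s (by linarith [hs.1, hη.2]) hs.2] at h
  exact mul_nonneg hC.le (by linarith)

theorem exists_eq_of_average (hP : ∀ p, HasDerivAt P (Q p) p) {a b : ℝ} (hab : a < b)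
    (h : P b - P a = α * (b - a)) : ∃ ξ ∈ Set.Ioo a b, Q ξ = α := by
  obtain ⟨ξ, hξ, he⟩ := exists_hasDerivAt_eq_slope P Q hab
    (fun t _ => (hP t).continuousAt.continuousWithinAt) (fun t _ => hP t)
  refine ⟨ξ, hξ, ?_⟩
  rw [he, h, mul_div_assoc, div_self (by linarith), mul_one]

theorem lt_average_of_le (hQ : StrictAntiOn Q (Set.Icc 0 1)) (hP : ∀ p, HasDerivAt P (Q p) p)
    {a b ξ : ℝ} (ha : 0 ≤ a) (hab : a < b) (hbξ : b ≤ ξ) (hξ : ξ ≤ 1) :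
    Q ξ * (b - a) < P b - P a := by
  obtain ⟨ζ, hζ, he⟩ := exists_hasDerivAt_eq_slope P Q hab
    (fun t _ => (hP t).continuousAt.continuousWithinAt) (fun t _ => hP t)
  have h1 : Q ξ < Q ζ := hQ ⟨by linarith [hζ.1], by linarith [hζ.2]⟩ ⟨by linarith, hξ⟩
    (by linarith [hζ.2])
  have h2 : 0 < b - a := by linarith
  rw [he, lt_div_iff₀ h2] at h1
  exact h1

theorem average_lt_of_le (hQ : StrictAntiOn Q (Set.Icc 0 1)) (hP : ∀ p, HasDerivAt P (Q p) p)
    {a b ξ : ℝ} (hξ : 0 ≤ ξ) (ha : ξ ≤ a) (hab : a < b) (hb : b ≤ 1) :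
    P b - P a < Q ξ * (b - a) := by
  obtain ⟨ζ, hζ, he⟩ := exists_hasDerivAt_eq_slope P Q hab
    (fun t _ => (hP t).continuousAt.continuousWithinAt) (fun t _ => hP t)
  have h1 : Q ζ < Q ξ := hQ ⟨hξ, by linarith [hζ.2]⟩ ⟨by linarith [hζ.1], by linarith [hζ.2]⟩
    (by linarith [hζ.1])
  have h2 : 0 < b - a := by linarith
  rw [he, div_lt_iff₀ h2] at h1
  exact h1

/-- Lowering the right endpoint of a locally correct interval cannot lower its left endpoint. -/
theorem left_le_left_of_right_le (hQ : StrictAntiOn Q (Set.Icc 0 1))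
    (hP : ∀ p, HasDerivAt P (Q p) p) {g v g' v' : ℝ} (hg : 0 < g) (hgv : g < v) (hv : v ≤ 1)
    (h : P v - P g = α * (v - g)) (hg' : 0 < g') (hgv' : g' < v') (hv' : v' ≤ v)
    (h' : P v' - P g' ≤ α * (v' - g')) : g ≤ g' := by
  by_contra! hlt
  obtain ⟨ξ, hξ, rfl⟩ := exists_eq_of_average hP hgv h
  rcases lt_or_ge v' ξ with hc | hc
  · have := lt_average_of_le hQ hP hg'.le hgv' hc.le (by linarith [hξ.2])
    linarith
  · have h1 := lt_average_of_le hQ hP hg'.le hlt hξ.1.le (by linarith [hξ.2])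
    rcases hv'.lt_or_eq with hc2 | rfl
    · have h2 := average_lt_of_le hQ hP (hg.trans hξ.1).le hc hc2 hv
      nlinarith
    · nlinarith

/-- Comparison of nested intervals with the same average of `Q`. -/
theorem add_le_add_of_nested (hQ : StrictAntiOn Q (Set.Icc 0 1))
    (hP : ∀ p, HasDerivAt P (Q p) p) {g v g' v' : ℝ} (hgv : g < v)
    (h : P v - P g = α * (v - g)) (hg' : 0 < g') (hvv' : v < v') (hv' : v' ≤ 1)
    (h' : P v' - P g' ≤ α * (v' - g'))
    (hq : ∀ t, (v - g) / 2 ≤ t → t < (g + v) / 2 → t < 1 - (g + v) / 2 →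
      2 * α ≤ Q ((g + v) / 2 - t) + Q ((g + v) / 2 + t)) : g + v ≤ g' + v' := by
  by_contra! hlt
  obtain ⟨ξ, hξ, hξα⟩ := exists_eq_of_average hP hgv h
  obtain ⟨t, ht, hte⟩ := exists_reflect_add_eq hP ((g + v) / 2) (a := (v - g) / 2)
    (b := v' - (g + v) / 2) (by linarith)
  have h1 := hq t ht.1.le (by linarith [ht.2]) (by linarith [ht.2])
  rw [show (g + v) / 2 + (v - g) / 2 = v by ring, show (g + v) / 2 - (v - g) / 2 = g by ring,
    show (g + v) / 2 + (v' - (g + v) / 2) = v' by ring,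
    show (g + v) / 2 - (v' - (g + v) / 2) = g + v - v' by ring] at hte
  have h2 := lt_average_of_le hQ hP hg'.le (show g' < g + v - v' by linarith)
    (show g + v - v' ≤ ξ by linarith [hξ.1]) (by linarith [hξ.2])
  rw [hξα] at h2
  have h3 : 2 * α * (v' - v) ≤ (Q ((g + v) / 2 - t) + Q ((g + v) / 2 + t)) * (v' - v) :=
    mul_le_mul_of_nonneg_right h1 (by linarith)
  have h4 : v' - (g + v) / 2 - (v - g) / 2 = v' - v := by ring
  rw [h4] at hte
  linarith

/-- Lower bound for the average of `Q` over an interval centred to the left of the mode `c`. -/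
theorem le_average_of_left_of_mode (hC : 0 < C)
    (hQ : ∀ p, HasDerivAt Q (-(C * (p ^ d * (1 - p) ^ k))) p)
    (hP : ∀ p, HasDerivAt P (Q p) p) {c g v : ℝ} (hc : d * (1 - c) = k * c) (hc2 : 1 / 2 ≤ c)
    (hg : 0 ≤ g) (hcv : c < v) (hv : v ≤ 1) (hM : g < 2 * c - v) :
    2 * (v - c) * Q c + (2 * c - v - g) * Q (2 * c - v) < P v - P g := by
  have hQs := strictAntiOn_of_tail hC hQ
  obtain ⟨t, ht, hte⟩ := exists_reflect_add_eq hP c (a := 0) (b := v - c) (by linarith)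
  have h1 := monotoneOn_reflect_add hC hQ (M := c) hc.le hc2 (a := 0) (b := t)
    ⟨le_rfl, by linarith⟩ ⟨ht.1.le, by linarith [ht.2]⟩ ht.1.le
  simp only [sub_zero, add_zero] at h1
  have h2 := lt_average_of_le hQs hP hg hM le_rfl (by linarith)
  simp only [sub_zero, add_zero, sub_self, add_sub_cancel,
    show c - (v - c) = 2 * c - v by ring] at hte
  have h3 : (Q c + Q c) * (v - c) ≤ (Q (c - t) + Q (c + t)) * (v - c) :=
    mul_le_mul_of_nonneg_right h1 (by linarith)
  linarith

/-- The comparison of `add_le_add_of_nested` holds unless the interval is centred in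
`(1 / 2, c)` with `c` the mode. -/
theorem two_mul_le_reflect_add (hC : 0 < C)
    (hQ : ∀ p, HasDerivAt Q (-(C * (p ^ d * (1 - p) ^ k))) p) (hQ0 : Q 0 = 1) (hQ1 : Q 1 = 0)
    (hP : ∀ p, HasDerivAt P (Q p) p) {g v : ℝ} (hgv : g < v)
    (h : P v - P g = α * (v - g)) (hα : α ≤ 1 / 2)
    (hc : (g + v) / 2 ≤ 1 / 2 ∨ d * (1 - (g + v) / 2) ≤ k * ((g + v) / 2))
    {t : ℝ} (hat : (v - g) / 2 ≤ t) (ht : t < (g + v) / 2) (ht1 : t < 1 - (g + v) / 2) :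
    2 * α ≤ Q ((g + v) / 2 - t) + Q ((g + v) / 2 + t) := by
  set M := (g + v) / 2 with hMdef
  obtain ⟨ξ, hξ, hξe⟩ := exists_reflect_add_eq hP M (a := 0) (b := (v - g) / 2) (by linarith)
  have hξα : Q (M - ξ) + Q (M + ξ) = 2 * α := by
    rw [show M + (v - g) / 2 = v by rw [hMdef]; ring,
      show M - (v - g) / 2 = g by rw [hMdef]; ring] at hξe
    simp only [add_zero, sub_zero, sub_self, h] at hξe
    have : 0 < v - g := by linarith
    apply mul_right_cancel₀ (b := v - g) this.ne'
    linarith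
  have hξt : ξ < t := hξ.2.trans_le hat
  have hend : M ≤ 1 / 2 → 2 * α ≤ Q (M - M) + Q (M + M) := by
    intro hM
    have h1 := (strictAntiOn_of_tail hC hQ).antitoneOn (a := M + M) (b := 1)
      ⟨by linarith [hξ.1], by linarith⟩ ⟨zero_le_one, le_rfl⟩ (by linarith)
    rw [sub_self, hQ0]
    linarith
  rcases le_total (d * (1 - M)) (k * M) with hm | hm
  · rcases le_total M (1 / 2) with hM | hM
    · refine le_trans (le_min hξα.ge (hend hM)) (min_le_reflect_add hC hQ hm hM hξ.1 hξt ht)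
    · rw [← hξα]
      exact monotoneOn_reflect_add hC hQ hm hM ⟨hξ.1.le, by linarith⟩ ⟨by linarith [hξ.1], ht1.le⟩
        hξt.le
  · have hfin : M ≤ 1 / 2 → 2 * α ≤ Q (M - t) + Q (M + t) := fun hM =>
      (hend hM).trans (antitoneOn_reflect_add hC hQ hm hM ⟨by linarith [hξ.1], ht.le⟩
        ⟨by linarith [hξ.1], le_rfl⟩ ht.le)
    rcases hc with hM | hm2
    · exact hfin hM
    · rcases le_total M (1 / 2) with hM | hM
      · exact hfin hM
      · rw [← hξα]
        exact monotoneOn_reflect_add hC hQ hm2 hM ⟨hξ.1.le, by linarith⟩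
          ⟨by linarith [hξ.1], ht1.le⟩ hξt.le

/-- An interval centred in `(1 / 2, c)`, with `c` the mode, has average larger than `Q c`. -/
theorem mode_lt_average (hC : 0 < C)
    (hQ : ∀ p, HasDerivAt Q (-(C * (p ^ d * (1 - p) ^ k))) p)
    (hP : ∀ p, HasDerivAt P (Q p) p) {c g v : ℝ} (hc : d * (1 - c) = k * c) (hc2 : 1 / 2 ≤ c)
    (hc1 : c ≤ 1) (hg : 0 ≤ g) (hgv : g < v) (hv : v ≤ 1) (hM : g < 2 * c - v) :
    Q c * (v - g) < P v - P g := by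
  have hQs := strictAntiOn_of_tail hC hQ
  rcases le_or_gt v c with hvc | hvc
  · exact lt_average_of_le hQs hP hg hgv hvc hc1
  · have h1 := le_average_of_left_of_mode hC hQ hP hc hc2 hg hvc hv hM
    have h2 := hQs (a := 2 * c - v) (b := c) ⟨by linarith, by linarith⟩ ⟨by linarith, by linarith⟩
      (by linarith)
    nlinarith

end tail

theorem B_eq_eval (n x : ℕ) (p : ℝ) : B n x p = (bernsteinPolynomial ℝ n x).eval p := by
  simp [B, bernsteinPolynomial]

theorem continuous_B (n x : ℕ) : Continuous (B n x) := by
  unfold B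
  fun_prop

theorem sum_B (n : ℕ) (p : ℝ) : ∑ x ∈ Finset.range (n + 1), B n x p = 1 := by
  simp only [B_eq_eval, ← Polynomial.eval_finsetSum, bernsteinPolynomial.sum, Polynomial.eval_one]

/-- The lower tail `P(X < i)` of the binomial distribution. -/
noncomputable def lowerTail (n i : ℕ) (p : ℝ) : ℝ := ∑ x ∈ Finset.range i, B n x p

theorem continuous_lowerTail (n i : ℕ) : Continuous (lowerTail n i) :=
  continuous_finsetSum _ fun x _ => continuous_B n x

theorem sum_Icc_B {n i : ℕ} (hi : i ≤ n) (p : ℝ) :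
    ∑ x ∈ Finset.Icc i n, B n x p = 1 - lowerTail n i p := by
  rw [← sum_B n p, lowerTail, eq_sub_iff_add_eq, add_comm,
    ← Finset.sum_range_add_sum_Ico _ (show i ≤ n + 1 by omega)]
  rfl

theorem hasDerivAt_lowerTail (m j : ℕ) (p : ℝ) :
    HasDerivAt (lowerTail (m + 1) (j + 1)) (-((m + 1) * B m j p)) p := by
  have hB : ∀ x, HasDerivAt (B (m + 1) x)
      ((Polynomial.derivative (bernsteinPolynomial ℝ (m + 1) x)).eval p) p := fun x => by
    have := (bernsteinPolynomial ℝ (m + 1) x).hasDerivAt p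
    exact this.congr_of_eventuallyEq (.of_forall fun p => B_eq_eval _ _ _)
  induction j with
  | zero =>
    have h := hB 0
    rw [bernsteinPolynomial.derivative_zero] at h
    have e : lowerTail (m + 1) (0 + 1) = B (m + 1) 0 := by
      ext p; simp [lowerTail]
    rw [e]
    refine h.congr_deriv ?_
    simp [B_eq_eval]
    ring
  | succ j ih =>
    have h := hB (j + 1)
    rw [bernsteinPolynomial.derivative_succ] at h
    have e : lowerTail (m + 1) (j + 1 + 1) =
        lowerTail (m + 1) (j + 1) + B (m + 1) (j + 1) := by
      ext p; simp [lowerTail, Finset.sum_range_succ]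
    rw [e]
    refine (ih.add h).congr_deriv ?_
    simp [B_eq_eval]
    ring

theorem B_zero_right (n x : ℕ) : B n x 0 = if x = 0 then 1 else 0 := by
  rw [B_eq_eval, bernsteinPolynomial.eval_at_0]

theorem lowerTail_zero_right (n j : ℕ) : lowerTail n (j + 1) 0 = 1 := by
  simp [lowerTail, B_zero_right]

theorem lowerTail_one_right {n i : ℕ} (hi : i ≤ n) : lowerTail n i 1 = 0 := by
  refine Finset.sum_eq_zero fun x hx => ?_
  have := Finset.mem_range.1 hx
  rw [B_eq_eval, bernsteinPolynomial.eval_at_1, if_neg (by omega)]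

theorem integral_B {n x : ℕ} (hx : x ≤ n) : ∫ p in (0 : ℝ)..1, B n x p = 1 / (n + 1) := by
  have h := intervalIntegral.integral_eq_sub_of_hasDerivAt (a := 0) (b := 1)
    (fun p _ => hasDerivAt_lowerTail n x p)
    (((continuous_B n x).const_mul _).neg.intervalIntegrable _ _)
  rw [intervalIntegral.integral_neg, intervalIntegral.integral_const_mul, lowerTail_zero_right,
    lowerTail_one_right (by omega)] at h
  rw [eq_div_iff (by positivity)]
  linarith

theorem integral_sum_mul_B (n : ℕ) (w : ℕ → ℝ) :
    ∫ p in (0 : ℝ)..1, ∑ x ∈ Finset.range (n + 1), w x * B n x p =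
      (∑ x ∈ Finset.range (n + 1), w x) / (n + 1) := by
  rw [intervalIntegral.integral_finsetSum
    fun x _ => ((continuous_B n x).const_mul _).intervalIntegrable _ _, Finset.sum_div]
  refine Finset.sum_congr rfl fun x hx => ?_
  rw [intervalIntegral.integral_const_mul, integral_B (by simpa [Nat.lt_succ_iff] using hx)]
  ring

/-- A primitive of the lower tail. -/
noncomputable def lowerTailPrimitive (n i : ℕ) (p : ℝ) : ℝ := ∫ q in (0 : ℝ)..p, lowerTail n i q

theorem hasDerivAt_lowerTailPrimitive (n i : ℕ) (p : ℝ) :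
    HasDerivAt (lowerTailPrimitive n i) (lowerTail n i p) p :=
  (continuous_lowerTail n i).integral_hasStrictDerivAt 0 p |>.hasDerivAt

theorem integral_sum_Icc_B {n i : ℕ} (hi : i ≤ n) (a b : ℝ) :
    ∫ p in a..b, ∑ x ∈ Finset.Icc i n, B n x p =
      (b - a) - (lowerTailPrimitive n i b - lowerTailPrimitive n i a) := by
  simp only [sum_Icc_B hi]
  have hii : ∀ a b, IntervalIntegrable (lowerTail n i) volume a b :=
    fun a b => (continuous_lowerTail n i).intervalIntegrable a b
  rw [intervalIntegral.integral_sub (by simp) (hii a b), lowerTailPrimitive, lowerTailPrimitive,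
    intervalIntegral.integral_interval_sub_left (hii _ _) (hii _ _)]
  simp

theorem succ_mul_B {n x : ℕ} (hx : x < n) (p : ℝ) :
    (x + 1) * (1 - p) * B n (x + 1) p = (n - x) * p * B n x p := by
  have h : ((n.choose (x + 1) : ℕ) : ℝ) * (x + 1) = n.choose x * (n - x) := by
    have := Nat.choose_succ_right_eq n x
    rw [← Nat.cast_sub hx.le]
    exact_mod_cast this
  obtain ⟨r, rfl⟩ : ∃ r, n = x + 1 + r := ⟨n - (x + 1), by omega⟩
  unfold B
  rw [show x + 1 + r - (x + 1) = r by omega, show x + 1 + r - x = r + 1 by omega]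
  linear_combination p ^ (x + 1) * (1 - p) ^ (r + 1) * h

theorem B_nonneg (n x : ℕ) {p : ℝ} (h0 : 0 ≤ p) (h1 : p ≤ 1) : 0 ≤ B n x p := by
  have : 0 ≤ 1 - p := by linarith
  unfold B
  positivity

section mode

variable {d k : ℕ}

theorem mode_mul_B_succ (hk : 0 < k) {x : ℕ} (hx : x < d + k + 1) :
    (x + 1) * k * B (d + k + 1) (x + 1) (d / (d + k)) =
      ((d + k + 1) - x) * d * B (d + k + 1) x (d / (d + k)) := by
  have h := succ_mul_B hx (d / (d + k) : ℝ)
  have hk' : (0 : ℝ) < k := by exact_mod_cast hk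
  have hN : (0 : ℝ) < d + k := by positivity
  rw [show 1 - (d / (d + k) : ℝ) = k / (d + k) by field_simp; ring] at h
  field_simp at h
  push_cast at h
  linarith

theorem mode_B_nonneg (d k n x : ℕ) : 0 ≤ B n x (d / (d + k)) :=
  B_nonneg _ _ (by positivity) (div_le_one_of_le₀ (by linarith [k.cast_nonneg (α := ℝ)])
    (by positivity))

/-- A bound, uniform in `d ≥ k`, for the ratio of the upper to the lower binomial probabilities
at distance `j` from the mode, scaled by `k ^ (2 * j)`. -/
def reflectRatioBound (k : ℕ) : ℕ → ℕ
  | 0 => 1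
  | j + 1 => reflectRatioBound k j * max (k ^ 2) ((k + 1) ^ 2 - (j + 1) ^ 2)

theorem pow_mul_reflectRatioBound_le (k : ℕ) {i j : ℕ} (hij : i ≤ j) :
    k ^ (2 * (j - i)) * reflectRatioBound k i ≤ reflectRatioBound k j := by
  induction j, hij using Nat.le_induction with
  | base => simp
  | succ j hij ih =>
    rw [show 2 * (j + 1 - i) = 2 * (j - i) + 2 by omega, pow_add, mul_right_comm]
    exact Nat.mul_le_mul ih (le_max_left _ _)

theorem reflectRatioBound_le {k : ℕ} (hk : 4 ≤ k) (hk' : k < 100) {j : ℕ} (hj : j ≤ k) :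
    37 * ((k + 1) * reflectRatioBound k j) ≤ 100 * k ^ (2 * j + 1) := by
  have key : ∀ k < 100, 4 ≤ k →
      37 * ((k + 1) * reflectRatioBound k k) ≤ 100 * k ^ (2 * k + 1) := by
    decide +kernel
  have h1 := key k hk' hk
  have h2 := pow_mul_reflectRatioBound_le k hj
  have h3 : k ^ (2 * (k - j)) * k ^ (2 * j + 1) = k ^ (2 * k + 1) := by
    rw [← pow_add]
    congr 1
    omega
  refine le_of_mul_le_mul_left (a := k ^ (2 * (k - j))) ?_ (pow_pos (by omega) _)
  have h4 := Nat.mul_le_mul_left (37 * (k + 1)) h2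
  linarith

theorem mul_B_upper_le (hk : 0 < k) (hkd : k ≤ d) {j : ℕ} (hj : j ≤ k) :
    (k : ℝ) ^ (2 * j + 1) * B (d + k + 1) (d + 1 + j) (d / (d + k)) ≤
      (k + 1) * reflectRatioBound k j * B (d + k + 1) (d - j) (d / (d + k)) := by
  have hk' : (0 : ℝ) < k := by exact_mod_cast hk
  have hkd' : (k : ℝ) ≤ d := by exact_mod_cast hkd
  have hd' : (0 : ℝ) < d := by linarith
  induction j with
  | zero =>
    have h := mode_mul_B_succ (d := d) hk (x := d) (by omega)
    have h0 := mode_B_nonneg d k (d + k + 1) (d + 1)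
    simp only [reflectRatioBound, add_zero, Nat.sub_zero, mul_zero, zero_add, pow_one,
      Nat.cast_one, mul_one]
    refine le_of_mul_le_mul_left ?_ hd'
    nlinarith
  | succ j ih =>
    have ih := ih (by omega)
    have hjk : (j : ℝ) + 1 ≤ k := by exact_mod_cast hj
    have hjd : (0 : ℝ) < d - j := by linarith
    have h1 := mode_mul_B_succ (d := d) hk (x := d + 1 + j) (by omega)
    have h2 := mode_mul_B_succ (d := d) hk (x := d - (j + 1)) (by omega)
    rw [show d - (j + 1) + 1 = d - j by omega, Nat.cast_sub (by omega)] at h2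
    push_cast at h1 h2
    have hb := mode_B_nonneg d k (d + k + 1) (d - (j + 1))
    rw [show d + 1 + (j + 1) = d + 1 + j + 1 by omega, reflectRatioBound]
    set b := B (d + k + 1) (d - (j + 1)) (d / (d + k))
    set b' := B (d + k + 1) (d - j) (d / (d + k))
    set a := B (d + k + 1) (d + 1 + j) (d / (d + k))
    set a' := B (d + k + 1) (d + 1 + j + 1) (d / (d + k))
    set R : ℝ := (reflectRatioBound k j : ℝ)
    have hR : 0 ≤ R := Nat.cast_nonneg _
    push_cast [Nat.cast_sub (show (j + 1) ^ 2 ≤ (k + 1) ^ 2 by gcongr; omega)]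
    set w := max ((k : ℝ) ^ 2) ((k + 1) ^ 2 - (j + 1) ^ 2) with hw
    have hw1 : (k : ℝ) ^ 2 ≤ w := le_max_left _ _
    have hw2 : ((k : ℝ) + 1) ^ 2 - (j + 1) ^ 2 ≤ w := le_max_right _ _
    have hwf : (d : ℝ) ^ 2 * ((k + 1) ^ 2 - (j + 1) ^ 2) ≤ w * ((d + 1) ^ 2 - (j + 1) ^ 2) := by
      have hp : 0 ≤ ((d : ℝ) + 1) ^ 2 - (j + 1) ^ 2 := by nlinarith
      rcases le_total (((j : ℝ) + 1) ^ 2) (2 * (k : ℝ) + 1) with hs | hs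
      · refine le_trans ?_ (mul_le_mul_of_nonneg_right hw2 hp)
        have : 0 ≤ ((k : ℝ) + 1) ^ 2 - (j + 1) ^ 2 := by nlinarith
        nlinarith
      · refine le_trans ?_ (mul_le_mul_of_nonneg_right hw1 hp)
        have h3 : 0 ≤ ((d : ℝ) - k) * (d + k) * ((j + 1) ^ 2 - (2 * k + 1)) :=
          mul_nonneg (mul_nonneg (by linarith) (by linarith)) (by linarith)
        have h4 : 0 ≤ ((d : ℝ) - k) * k ^ 2 := mul_nonneg (by linarith) (by positivity)
        linarith
    have hq : (0 : ℝ) < (d + 2 + j) * k * ((d - j) * k) := by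
      have : (0 : ℝ) < d + 2 + j := by positivity
      positivity
    refine le_of_mul_le_mul_left ?_ hq
    have e1 : ((d : ℝ) + 2 + j) * k * a' = (k - j) * d * a := by linear_combination h1
    have e2 : ((d : ℝ) - j) * k * b' = (k + 2 + j) * d * b := by linear_combination h2
    calc ((d : ℝ) + 2 + j) * k * ((d - j) * k) * (k ^ (2 * (j + 1) + 1) * a')
        = ((d - j) * k * k ^ 2 * ((k - j) * d)) * (k ^ (2 * j + 1) * a) := by
          rw [show 2 * (j + 1) + 1 = (2 * j + 1) + 2 by ring, pow_add]
          linear_combination ((d - j) * k) * (k ^ (2 * j + 1) * k ^ 2) * e1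
      _ ≤ ((d - j) * k * k ^ 2 * ((k - j) * d)) * ((k + 1) * R * b') := by
          refine mul_le_mul_of_nonneg_left ih ?_
          have : (0 : ℝ) ≤ k - j := by linarith
          positivity
      _ = (k + 1) * R * b * k ^ 2 * (d ^ 2 * ((k + 1) ^ 2 - (j + 1) ^ 2)) := by
          linear_combination (k ^ 2 * ((k - j) * d)) * ((k + 1) * R) * e2
      _ ≤ (k + 1) * R * b * k ^ 2 * (w * ((d + 1) ^ 2 - (j + 1) ^ 2)) := by
          gcongr
      _ = _ := by ring

theorem le_lowerTail_mode (hk : 2 ≤ k) (hk' : k < 100) (hkd : k ≤ d) :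
    27 / 100 ≤ lowerTail (d + k + 1) (d + 1) (d / (d + k)) := by
  have hsum := sum_B (d + k + 1) (d / (d + k))
  rw [show d + k + 1 + 1 = (d + 1) + (k + 1) by ring, Finset.sum_range_add] at hsum
  change lowerTail _ _ _ + _ = _ at hsum
  have hlow : ∑ j ∈ Finset.range (k + 1), B (d + k + 1) (d - j) (d / (d + k)) ≤
      lowerTail (d + k + 1) (d + 1) (d / (d + k)) := by
    rw [lowerTail, ← Finset.sum_range_reflect _ (d + 1)]
    exact Finset.sum_le_sum_of_subset_of_nonneg (Finset.range_mono (by omega))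
      fun j _ _ => mode_B_nonneg _ _ _ _
  suffices h : 37 / 100 * ∑ j ∈ Finset.range (k + 1), B (d + k + 1) (d + 1 + j) (d / (d + k)) ≤
      ∑ j ∈ Finset.range (k + 1), B (d + k + 1) (d - j) (d / (d + k)) by
    linarith
  have hd : (2 : ℝ) ≤ d := by exact_mod_cast hk.trans hkd
  have hpos := fun x => mode_B_nonneg d k (d + k + 1) x
  have hrec := fun x => mode_mul_B_succ (d := d) (k := k) (by omega) (x := x)
  rcases lt_or_ge k 4 with hk4 | hk4
  · have hle : ∀ {x y s t r : ℝ}, 0 ≤ y → 0 < r → r * x = s * y → s ≤ t * r → x ≤ t * y := by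
      intro x y s t r hy hr h hs
      refine le_of_mul_le_mul_left ?_ hr
      nlinarith
    have hcast : ((d - 1 : ℕ) : ℝ) = d - 1 := by
      rw [Nat.cast_sub (by omega), Nat.cast_one]
    have r0 := hrec d (by omega)
    have r1 := hrec (d + 1) (by omega)
    have r2 := hrec (d + 2) (by omega)
    have r3 := hrec (d - 1) (by omega)
    rw [Nat.sub_add_cancel (by omega), hcast] at r3
    obtain rfl | rfl : k = 2 ∨ k = 3 := by omega
    · simp only [Finset.sum_range_succ, Finset.sum_range_zero, Nat.sub_zero, add_zero]
      push_cast at *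
      have a0 := hle (t := 3 / 2) (hpos _) (by linarith) r0 (by linarith)
      have a1 := hle (t := 1) (hpos _) (by linarith) r1 (by linarith)
      have a2 := hle (t := 1 / 2) (hpos _) (by linarith) r2 (by linarith)
      have a3 := hle (t := 2) (hpos _) (by linarith) r3 (by linarith)
      have := hpos (d + 1)
      have := hpos (d - 2)
      simp only [add_assoc, Nat.reduceAdd] at *
      linarith
    · have r4 := hrec (d + 3) (by omega)
      simp only [Finset.sum_range_succ, Finset.sum_range_zero, Nat.sub_zero, add_zero]
      push_cast at *
      have a0 := hle (t := 4 / 3) (hpos _) (by linarith) r0 (by linarith)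
      have a1 := hle (t := 1) (hpos _) (by linarith) r1 (by linarith)
      have a2 := hle (t := 2 / 3) (hpos _) (by linarith) r2 (by linarith)
      have a3 := hle (t := 5 / 3) (hpos _) (by linarith) r3 (by linarith)
      have a4 := hle (t := 1 / 3) (hpos _) (by linarith) r4 (by linarith)
      have := hpos (d + 1)
      have := hpos (d - 2)
      have := hpos (d - 3)
      simp only [add_assoc, Nat.reduceAdd] at *
      linarith
  · rw [Finset.mul_sum]
    refine Finset.sum_le_sum fun j hj => ?_
    have hj : j ≤ k := by simpa [Nat.lt_succ_iff] using hj
    have h1 := mul_B_upper_le (d := d) (by omega) hkd hj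
    have h2 : (37 : ℝ) * ((k + 1) * reflectRatioBound k j) ≤ 100 * k ^ (2 * j + 1) := by
      exact_mod_cast reflectRatioBound_le hk4 hk' hj
    have h3 : (0 : ℝ) < k ^ (2 * j + 1) := by
      have : (0 : ℝ) < k := by exact_mod_cast (by omega : 0 < k)
      positivity
    have h4 := mul_le_mul_of_nonneg_right h2 (hpos (d - j))
    refine le_of_mul_le_mul_left ?_ h3
    linarith

end mode

theorem sub_eq_sub_of_hasDerivAt {P H Q : ℝ → ℝ} (hP : ∀ p, HasDerivAt P (Q p) p)
    (hH : ∀ p, HasDerivAt H (Q p) p) (a b : ℝ) : P b - P a = H b - H a := by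
  have h : ∀ p, HasDerivAt (fun p => P p - H p) 0 p := fun p => by
    exact ((hP p).sub (hH p)).congr_deriv (sub_self _)
  have := is_const_of_deriv_eq_zero (fun p => (h p).differentiableAt) (fun p => (h p).deriv) a b
  linarith

theorem lowerTail_self (n : ℕ) (p : ℝ) : lowerTail n n p = 1 - p ^ n := by
  have h := sum_B n p
  rw [Finset.sum_range_succ] at h
  change lowerTail n n p + _ = _ at h
  simp only [B, Nat.choose_self, Nat.sub_self, pow_zero, mul_one, Nat.cast_one, one_mul] at h
  linarith

theorem lowerTail_succ_left (N : ℕ) (p : ℝ) :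
    lowerTail (N + 1) N p = 1 - (N + 1) * p ^ N + N * p ^ (N + 1) := by
  have h := lowerTail_self (N + 1) p
  rw [lowerTail, Finset.sum_range_succ] at h
  change lowerTail (N + 1) N p + _ = _ at h
  simp only [B, Nat.choose_succ_self_right, Nat.add_sub_cancel_left, pow_one] at h
  push_cast at h
  linear_combination h

theorem hasDerivAt_primitive_lowerTail_self (n : ℕ) (p : ℝ) :
    HasDerivAt (fun p : ℝ => p - p ^ (n + 1) / (n + 1)) (lowerTail n n p) p := by
  refine ((hasDerivAt_id p).sub ((hasDerivAt_pow (n + 1) p).div_const _)).congr_deriv ?_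
  rw [lowerTail_self]
  push_cast
  field_simp

theorem hasDerivAt_primitive_lowerTail_succ_left (N : ℕ) (p : ℝ) :
    HasDerivAt (fun p : ℝ => p - p ^ (N + 1) + N / (N + 2) * p ^ (N + 2))
      (lowerTail (N + 1) N p) p := by
  refine (((hasDerivAt_id p).sub (hasDerivAt_pow (N + 1) p)).add
    ((hasDerivAt_pow (N + 2) p).const_mul _)).congr_deriv ?_
  rw [lowerTail_succ_left]
  push_cast
  field_simp

theorem one_sub_le_exp_neg_sub {y : ℝ} (h0 : 0 ≤ y) (h1 : y < 1) :
    1 - y ≤ Real.exp (-(y + y ^ 2 / 2)) := by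
  have h := sum_le_hasSum (Finset.range 2) (fun i _ => by positivity)
    (Real.hasSum_pow_div_log_of_abs_lt_one (show |y| < 1 by rwa [abs_of_nonneg h0]))
  rw [← Real.log_le_iff_le_exp (by linarith)]
  norm_num [Finset.sum_range_succ] at h
  linarith

theorem exp_two_mul_le {s : ℝ} (h0 : 0 ≤ s) (h1 : s < 1) :
    Real.exp (2 * s) ≤ (1 + s) / (1 - s) := by
  have h := sum_le_hasSum (Finset.range 1) (fun i _ => by positivity)
    (Real.hasSum_log_sub_log_of_abs_lt_one (show |s| < 1 by rwa [abs_of_nonneg h0]))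
  rw [← Real.le_log_iff_exp_le (div_pos (by linarith) (by linarith)),
    Real.log_div (by linarith) (by linarith)]
  norm_num at h
  linarith

theorem one_sub_inv_pow_le {N : ℕ} (hN : 2 ≤ N) :
    (1 - 1 / (N : ℝ)) ^ N ≤ Real.exp (-1 - 1 / (2 * N)) := by
  have hN' : (2 : ℝ) ≤ N := by exact_mod_cast hN
  have h0 : (0 : ℝ) < N := by linarith
  have h1 : 1 / (N : ℝ) < 1 := by rw [div_lt_one h0]; linarith
  refine (pow_le_pow_left₀ (by linarith) (one_sub_le_exp_neg_sub (by positivity) h1) N).trans ?_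
  rw [← Real.exp_nat_mul]
  apply le_of_eq
  congr 1
  field_simp
  ring

theorem exp_neg_le_of_le {x r b : ℝ} (hb : 0 < b)
    (h : 1 ≤ b * (2.7182818283 * (1 + r))) (hr : r ≤ x - 1) (hr1 : 0 ≤ 1 + r) :
    Real.exp (-x) ≤ b := by
  have h1 : Real.exp x = Real.exp 1 * Real.exp (x - 1) := by rw [← Real.exp_add]; ring_nf
  have h2 := Real.exp_one_gt_d9
  have h3 := Real.add_one_le_exp (x - 1)
  rw [Real.exp_neg, inv_le_comm₀ (Real.exp_pos _) hb, inv_le_iff_one_le_mul₀ hb, mul_comm, h1]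
  refine h.trans (mul_le_mul_of_nonneg_left ?_ hb.le)
  exact mul_le_mul h2.le (by linarith) hr1 (Real.exp_pos _).le

/-- A number just below `exp (33 / 50)`. -/
theorem lt_exp_tail : (193479 / 100000 : ℝ) < Real.exp (33 / 50) := by
  refine lt_of_lt_of_le ?_ (Real.sum_le_exp_of_nonneg (by norm_num) 9)
  norm_num [Finset.sum_range_succ, Nat.factorial]

theorem exp_neg_tail : (5109 / 10000 : ℝ) ≤ Real.exp (-(67 / 100)) := by
  have h := Real.exp_bound' (x := 67 / 100) (by norm_num) (by norm_num) (n := 8) (by norm_num)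
  rw [Real.exp_neg, le_inv_comm₀ (by norm_num) (Real.exp_pos _)]
  refine h.trans ?_
  norm_num [Finset.sum_range_succ, Nat.factorial]

theorem one_sub_exp_neg_le {z : ℝ} (hz : 67 / 100 ≤ z) :
    1 - Real.exp (-z) ≤ 73 / 100 * z := by
  have h1 : Real.exp (-z) = Real.exp (-(67 / 100)) * Real.exp (67 / 100 - z) := by
    rw [← Real.exp_add]; ring_nf
  have h2 := exp_neg_tail
  have h3 := Real.add_one_le_exp (67 / 100 - z)
  rcases le_total z (167 / 100) with hz1 | hz1
  · have h4 : 5109 / 10000 * (67 / 100 - z + 1) ≤ Real.exp (-z) := by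
      rw [h1]
      exact mul_le_mul h2 h3 (by linarith) (Real.exp_pos _).le
    linarith
  · have := Real.exp_pos (-z)
    linarith

theorem one_sub_one_sub_pow_le {N : ℕ} (hN : 0 < N) {y : ℝ} (h0 : 0 ≤ y) (h1 : y ≤ 1) :
    1 - (1 - y) ^ (N + 2) ≤ (N + 2) / N * (1 - Real.exp (-(N * y))) := by
  have hN' : (0 : ℝ) < N := by exact_mod_cast hN
  have hd : ∀ y : ℝ, HasDerivAt
      (fun y : ℝ => (N + 2) / N * (1 - Real.exp (-(N * y))) + (1 - y) ^ (N + 2))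
      ((N + 2) * (Real.exp (-(N * y)) - (1 - y) ^ (N + 1))) y := fun y => by
    have e1 := ((((hasDerivAt_id y).const_mul (N : ℝ)).neg.exp.const_sub 1).const_mul
      (((N : ℝ) + 2) / N))
    have e2 := ((hasDerivAt_id y).const_sub 1).pow (N + 2)
    refine (e1.add e2).congr_deriv ?_
    simp only [id_eq, Pi.neg_apply, Nat.add_succ_sub_one]
    push_cast
    field_simp
    ring
  have hm : MonotoneOn
      (fun y : ℝ => (N + 2) / N * (1 - Real.exp (-(N * y))) + (1 - y) ^ (N + 2))
      (Set.Icc 0 1) := by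
    apply monotoneOn_of_hasDerivWithinAt_nonneg (convex_Icc _ _)
      (fun y _ => (hd y).continuousAt.continuousWithinAt)
      (fun y _ => (hd y).hasDerivWithinAt)
    intro y hy
    rw [interior_Icc] at hy
    have h2 : (1 - y) ^ (N + 1) ≤ (1 - y) ^ N :=
      pow_le_pow_of_le_one (by linarith [hy.2]) (by linarith [hy.1]) (by omega)
    have h3 : (1 - y) ^ N ≤ Real.exp (-(N * y)) := by
      rw [← mul_neg, Real.exp_nat_mul]
      exact pow_le_pow_left₀ (by linarith [hy.2]) (Real.one_sub_le_exp_neg y) N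
    have : (0 : ℝ) < N + 2 := by linarith
    exact mul_nonneg this.le (by linarith)
  have := hm ⟨le_rfl, zero_le_one⟩ ⟨h0, h1⟩ h0
  simp only [mul_zero, neg_zero, Real.exp_zero, sub_self, sub_zero, one_pow, zero_add] at this
  linarith

theorem lowerTail_succ_left_one_sub_div {N : ℕ} (hN : 0 < N) (x : ℝ) :
    lowerTail (N + 1) N (1 - x / N) = 1 - (1 + x) * (1 - x / N) ^ N := by
  have hN' : (N : ℝ) ≠ 0 := by exact_mod_cast hN.ne'
  rw [lowerTail_succ_left, pow_succ]
  field_simp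
  ring

theorem le_lowerTail_mode_one {N : ℕ} (hN : 2 ≤ N) (hN' : N < 50) :
    27 / 100 ≤ lowerTail (N + 1) N (1 - 1 / N) := by
  rw [lowerTail_succ_left_one_sub_div (by omega)]
  have h0 : (0 : ℝ) < N := by exact_mod_cast (by omega : 0 < N)
  have h1 : (N : ℝ) ≤ 49 := by exact_mod_cast (by omega : N ≤ 49)
  have h2 : (1 : ℝ) / 98 ≤ 1 / (2 * N) := one_div_le_one_div_of_le (by linarith) (by linarith)
  have h3 := one_sub_inv_pow_le hN
  have h4 := exp_neg_le_of_le (x := 1 + 1 / (2 * N)) (r := 1 / 98) (b := 365 / 1000)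
    (by norm_num) (by norm_num) (by linarith) (by norm_num)
  rw [neg_add'] at h4
  linarith

theorem mul_exp_neg_le {b : ℝ} (h0 : 33 / 100 ≤ b) (h1 : b ≤ 1) :
    (2 + b) * Real.exp (-(1 + b)) ≤ 73 / 100 - 3016 / 10000 * b := by
  have h2 := Real.exp_one_gt_d9
  have h3 := Real.sum_le_exp_of_nonneg (x := b) (by linarith) 4
  norm_num [Finset.sum_range_succ, Nat.factorial] at h3
  have h4 : 2718 / 1000 * (1 + b + b ^ 2 / 2 + b ^ 3 / 6) ≤ Real.exp (1 + b) := by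
    rw [Real.exp_add]
    exact mul_le_mul (by linarith) h3 (by positivity) (Real.exp_pos _).le
  have h5 : 2 + b ≤ 2718 / 1000 * (1 + b + b ^ 2 / 2 + b ^ 3 / 6) *
      (73 / 100 - 3016 / 10000 * b) := by
    nlinarith [mul_nonneg (sub_nonneg.2 h0) (sub_nonneg.2 h1),
      mul_nonneg (mul_nonneg (sub_nonneg.2 h0) (sub_nonneg.2 h1)) (sub_nonneg.2 h0),
      mul_nonneg (mul_nonneg (sub_nonneg.2 h0) (sub_nonneg.2 h1)) (sub_nonneg.2 h1),
      mul_nonneg (mul_nonneg (sub_nonneg.2 h0) (sub_nonneg.2 h1)) (sq_nonneg b)]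
  rw [Real.exp_neg, ← div_eq_mul_inv, div_le_iff₀ (Real.exp_pos _)]
  refine h5.trans ?_
  rw [mul_comm]
  exact mul_le_mul_of_nonneg_left h4 (by linarith)

theorem le_lowerTail_mode_add {N : ℕ} (hN : 2 ≤ N) (hN' : N < 200) {b ε : ℝ}
    (h0 : 33 / 100 ≤ b) (h1 : b ≤ 1) (hε : 13 / 1000 ≤ ε) :
    27 / 100 * (b + ε) ≤ b * lowerTail (N + 1) N (1 - 1 / N) +
      ε * lowerTail (N + 1) N (1 - (1 + b) / N) := by
  rw [lowerTail_succ_left_one_sub_div (by omega), lowerTail_succ_left_one_sub_div (by omega)]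
  have hN2 : (2 : ℝ) ≤ N := by exact_mod_cast hN
  have hN1 : (N : ℝ) ≤ 199 := by exact_mod_cast (by omega : N ≤ 199)
  have h2 : (1 : ℝ) / 398 ≤ 1 / (2 * N) := one_div_le_one_div_of_le (by linarith) (by linarith)
  have h3 := one_sub_inv_pow_le hN
  have h4 := exp_neg_le_of_le (x := 1 + 1 / (2 * N)) (r := 1 / 398) (b := 36696 / 100000)
    (by norm_num) (by norm_num) (by linarith) (by norm_num)
  rw [neg_add'] at h4
  have h5 := Real.one_sub_div_pow_le_exp_neg (n := N) (t := 1 + b) (by linarith)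
  have h6 := mul_exp_neg_le h0 h1
  have h7 : (2 + b) * (1 - (1 + b) / N) ^ N ≤ 73 / 100 - 3016 / 10000 * b :=
    (mul_le_mul_of_nonneg_left h5 (by linarith)).trans h6
  have h8 : b * (1 - 1 / (N : ℝ)) ^ N ≤ b * (36696 / 100000) :=
    mul_le_mul_of_nonneg_left (h3.trans h4) (by linarith)
  have h9 := mul_le_mul_of_nonneg_left h7 (by linarith : 0 ≤ ε)
  nlinarith [mul_nonneg (by linarith : 0 ≤ b) (sub_nonneg.2 hε)]

theorem penultimate_endpoint {N : ℕ} (hN : 0 < N) {α v : ℝ} (hα : α < 27 / 100) (hv0 : 0 ≤ v)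
    (hv1 : v < 1) (h : (1 - (1 : ℝ) ^ (N + 2) / (N + 2)) - (v - v ^ (N + 2) / (N + 2)) =
      α * (1 - v)) : N * (1 - v) < 67 / 100 := by
  have hN' : (0 : ℝ) < N := by exact_mod_cast hN
  by_contra! hz
  have h1 := one_sub_one_sub_pow_le hN (y := 1 - v) (by linarith) (by linarith)
  have h2 := mul_le_mul_of_nonneg_left (one_sub_exp_neg_le hz)
    (by positivity : (0 : ℝ) ≤ (N + 2) / N)
  rw [sub_sub_cancel] at h1
  have h3 := h1.trans h2
  field_simp at h h3
  rw [one_pow] at h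
  have h4 : α * (N + 2) * (1 - v) < 27 / 100 * (N + 2) * (1 - v) := by
    have : 0 < 1 - v := by linarith
    gcongr
  linarith

theorem padeLike_lt {η ε : ℝ} (h0 : 0 ≤ η) (h1 : η ≤ 1 / 50) (hε0 : 0 ≤ ε)
    (hε1 : ε ≤ 13 / 1000) :
    (1 - η * (1 + ε + 33 / 100)) * (2 + (1 + ε + 33 / 100)) +
        33 / 100 * (1 + (1 + ε + 33 / 100)) * (1 + 2 * η) <
      193479 / 100000 * (1 + 66 / 100 * (η * (1 + ε) + η ^ 2) + 2178 / 10000 * η ^ 2) *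
        ((1 - η * (1 + ε - 33 / 100)) * (2 + (1 + ε - 33 / 100)) -
          33 / 100 * (1 + (1 + ε - 33 / 100)) * (1 + 2 * η)) := by
  have hm : ∀ i j : ℕ, η ^ i * ε ^ j ≤ (1 / 50) ^ i * (13 / 1000) ^ j := fun i j => by gcongr
  have h11 := hm 1 1
  have h12 := hm 1 2
  have h20 := hm 2 0
  have h21 := hm 2 1
  have h22 := hm 2 2
  have h23 := hm 2 3
  have h30 := hm 3 0
  have h31 := hm 3 1
  have h32 := hm 3 2
  have h33 := hm 3 3
  simp only [pow_one, pow_zero, mul_one] at *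
  linarith

theorem average_lt_end {N : ℕ} (hN : 50 ≤ N) {ε : ℝ} (hε0 : 0 ≤ ε) (hε1 : ε ≤ 13 / 1000)
    {H : ℝ → ℝ} (hH : H = fun p : ℝ => p - p ^ (N + 1) + N / (N + 2) * p ^ (N + 2))
    {M s : ℝ} (hM : M = 1 - (1 + ε) / N) (hs : s = 33 / 100 / N) :
    H (M + s) - H (M - s) <
      (lowerTail (N + 1) N (M - s) + lowerTail (N + 1) N (M + s)) * s := by
  have hN' : (50 : ℝ) ≤ N := by exact_mod_cast hN
  have hN0 : (0 : ℝ) < N := by linarith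
  obtain ⟨η, hη⟩ : ∃ η : ℝ, η = 1 / N := ⟨_, rfl⟩
  have hη0 : 0 < η := by rw [hη]; positivity
  have hη1 : η ≤ 1 / 50 := by rw [hη]; exact one_div_le_one_div_of_le (by norm_num) hN'
  have hNη : N * η = 1 := by rw [hη]; field_simp
  have hM' : M = 1 - η * (1 + ε) := by rw [hM, hη]; ring
  have hs' : s = 33 / 100 * η := by rw [hs, hη]; ring
  have hηε : η * (1 + ε) ≤ 1 / 50 * (1 + 13 / 1000) := by gcongr
  have hηε0 : 0 ≤ η * (1 + ε) := by positivity
  have hs0 : 0 < s := by rw [hs']; positivity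
  have hpos : 0 < M - s := by linarith
  have hM0 : 0 < M := by linarith
  have hpow : 193479 / 100000 * (1 + 66 / 100 * (η * (1 + ε) + η ^ 2) + 2178 / 10000 * η ^ 2) *
      (M - s) ^ N ≤ (M + s) ^ N := by
    have e1 : (M + s) ^ N = ((1 + s / M) / (1 - s / M)) ^ N * (M - s) ^ N := by
      rw [← mul_pow]
      congr 1
      field_simp
    rw [e1]
    refine mul_le_mul_of_nonneg_right ?_ (pow_pos hpos _).le
    have e2 := exp_two_mul_le (s := s / M) (by positivity) (by rw [div_lt_one hM0]; linarith)
    refine le_trans ?_ (pow_le_pow_left₀ (Real.exp_pos _).le e2 N)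
    rw [← Real.exp_nat_mul]
    set δ := 66 / 100 * (η * (1 + ε) + η ^ 2) with hδ
    have e3 : 33 / 50 + δ ≤ N * (2 * (s / M)) := by
      have : N * (2 * (s / M)) = 66 / 100 / M := by
        rw [hs']
        field_simp
        linear_combination 66 * hNη
      rw [this, le_div_iff₀ hM0, hδ, hM']
      have := mul_nonneg hηε0 hηε0
      nlinarith [mul_nonneg hε0 (sq_nonneg η), mul_nonneg hηε0 (sq_nonneg η)]
    refine le_trans ?_ (Real.exp_le_exp.2 e3)
    rw [Real.exp_add]
    have hδ0 : 66 / 100 * η ≤ δ := by rw [hδ]; nlinarith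
    have e4 := Real.quadratic_le_exp_of_nonneg (x := δ) (by linarith)
    refine mul_le_mul lt_exp_tail.le (le_trans ?_ e4) (by positivity) (Real.exp_pos _).le
    nlinarith
  have hpade := padeLike_lt hη0.le hη1 hε0 hε1
  set W := 193479 / 100000 * (1 + 66 / 100 * (η * (1 + ε) + η ^ 2) + 2178 / 10000 * η ^ 2)
  have hden : 0 < (1 - η * (1 + ε - 33 / 100)) * (2 + (1 + ε - 33 / 100)) -
      33 / 100 * (1 + (1 + ε - 33 / 100)) * (1 + 2 * η) := by
    have := mul_nonneg hη0.le hε0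
    nlinarith [mul_nonneg hη0.le (sub_nonneg.2 hε1), mul_nonneg this (sub_nonneg.2 hε1)]
  have h1 := mul_lt_mul_of_pos_left hpade (pow_pos hpos N)
  have h2 := mul_le_mul_of_nonneg_right hpow hden.le
  have hN2 : (N : ℝ) / (N + 2) = 1 / (1 + 2 * η) := by
    rw [hη]
    field_simp
  rw [hH, lowerTail_succ_left, lowerTail_succ_left]
  simp only [pow_add (M + s) N, pow_add (M - s) N, hN2]
  generalize (M + s) ^ N = A at *
  generalize (M - s) ^ N = D at *
  have h3 : D * ((1 - η * (1 + ε + 33 / 100)) * (2 + (1 + ε + 33 / 100)) +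
        33 / 100 * (1 + (1 + ε + 33 / 100)) * (1 + 2 * η)) < A *
      ((1 - η * (1 + ε - 33 / 100)) * (2 + (1 + ε - 33 / 100)) -
        33 / 100 * (1 + (1 + ε - 33 / 100)) * (1 + 2 * η)) := by linarith
  have h4 : (0 : ℝ) < 1 + 2 * η := by linarith
  have e1 : (N : ℝ) * (M + s) = N - (1 + ε - 33 / 100) := by
    rw [hM', hs']
    linear_combination -(1 + ε - 33 / 100) * hNη
  have e2 : (N : ℝ) * (M - s) = N - (1 + ε + 33 / 100) := by
    rw [hM', hs']
    linear_combination -(1 + ε + 33 / 100) * hNη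
  have e3 : M + s = 1 - η * (1 + ε - 33 / 100) := by rw [hM', hs']; ring
  have e4 : M - s = 1 - η * (1 + ε + 33 / 100) := by rw [hM', hs']; ring
  rw [← sub_pos]
  have key : (1 - (N + 1) * D + N * (D * (M - s) ^ 1) +
      (1 - (N + 1) * A + N * (A * (M + s) ^ 1))) * s -
      (M + s - A * (M + s) ^ 1 + 1 / (1 + 2 * η) * (A * (M + s) ^ 2) -
        (M - s - D * (M - s) ^ 1 + 1 / (1 + 2 * η) * (D * (M - s) ^ 2))) =
      η / (1 + 2 * η) * (A *
      ((1 - η * (1 + ε - 33 / 100)) * (2 + (1 + ε - 33 / 100)) -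
        33 / 100 * (1 + (1 + ε - 33 / 100)) * (1 + 2 * η)) -
      D * ((1 - η * (1 + ε + 33 / 100)) * (2 + (1 + ε + 33 / 100)) +
        33 / 100 * (1 + (1 + ε + 33 / 100)) * (1 + 2 * η))) := by
    rw [show (N : ℝ) * (D * (M - s) ^ 1) = D * (N * (M - s)) by ring,
      show (N : ℝ) * (A * (M + s) ^ 1) = A * (N * (M + s)) by ring, e1, e2, e3, e4, hs']
    field_simp
    ring
  rw [key]
  exact mul_pos (by positivity) (by linarith)

theorem hasDerivAt_lowerTail_mode (d k : ℕ) (p : ℝ) :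
    HasDerivAt (lowerTail (d + k + 1) (d + 1))
      (-((d + k + 1) * (d + k).choose d * (p ^ d * (1 - p) ^ k))) p := by
  refine (hasDerivAt_lowerTail (d + k) d p).congr_deriv ?_
  rw [B, Nat.add_sub_cancel_left]
  push_cast
  ring

theorem mode_constant_pos (d k : ℕ) : (0 : ℝ) < (d + k + 1) * (d + k).choose d := by
  have : 0 < (d + k).choose d := Nat.choose_pos (by omega)
  positivity

theorem two_mul_le_reflect_add_penultimate {d : ℕ} (hd : 49 ≤ d) (hd' : d < 199) {α g v : ℝ}
    (hα : α < 27 / 100) (hg : 0 ≤ g) (hgv : g < v) (hv : v < 1) {P : ℝ → ℝ}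
    (hP : ∀ p, HasDerivAt P (lowerTail (d + 1 + 1) (d + 1) p) p)
    (h : P v - P g = α * (v - g)) (hX : (d + 1) * (1 - v) < 67 / 100)
    (hM : (g + v) / 2 < 1 - 1 / (d + 1)) {t : ℝ} (hat : (v - g) / 2 ≤ t)
    (ht : t < 1 - (g + v) / 2) :
    2 * α ≤ lowerTail (d + 1 + 1) (d + 1) ((g + v) / 2 - t) +
      lowerTail (d + 1 + 1) (d + 1) ((g + v) / 2 + t) := by
  have hC := mode_constant_pos d 1
  have hQ := hasDerivAt_lowerTail_mode d 1
  have hH := hasDerivAt_primitive_lowerTail_succ_left (d + 1)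
  rw [sub_eq_sub_of_hasDerivAt hP hH] at h
  have hadd := fun b ε => le_lowerTail_mode_add (N := d + 1) (b := b) (ε := ε)
    (by omega) (by omega)
  have havg := fun ε hε0 hε1 => average_lt_end (N := d + 1) (by omega) (ε := ε) hε0 hε1 rfl
    (M := (g + v) / 2) (s := 33 / 100 / (d + 1 : ℕ))
  push_cast at *
  set H : ℝ → ℝ := fun p => p - p ^ (d + 1 + 1) + (d + 1) / (d + 1 + 2) * p ^ (d + 1 + 2)
  set Q := lowerTail (d + 1 + 1) (d + 1)
  obtain ⟨M, rfl⟩ : ∃ M, g = 2 * M - v := ⟨(g + v) / 2, by ring⟩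
  rw [show (2 * M - v + v) / 2 = M by ring] at *
  rw [show (v - (2 * M - v)) / 2 = v - M by ring] at *
  have hd1 : (49 : ℝ) ≤ d := by exact_mod_cast hd
  have hN0 : (0 : ℝ) < d + 1 := by linarith
  obtain ⟨ε, hε⟩ : ∃ ε, ε = (d + 1) * (1 - M) - 1 := ⟨_, rfl⟩
  have hMε : M = 1 - (1 + ε) / (d + 1) := by rw [hε]; field_simp; ring
  obtain ⟨b, hb⟩ : ∃ b, b = 1 - (d + 1) * (1 - v) := ⟨_, rfl⟩
  have hvb : v = 1 - (1 - b) / (d + 1) := by rw [hb]; field_simp; ring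
  have hb1 : b ≤ 1 := by
    have := mul_nonneg hN0.le (sub_nonneg.2 hv.le)
    linarith
  have hε0 : 0 < ε := by
    rw [hMε, sub_lt_sub_iff_left, div_lt_div_iff_of_pos_right hN0] at hM
    linarith
  have hε1 : ε < 13 / 1000 := by
    by_contra! hge
    have hinv : 1 / (d + 1 : ℝ) ≤ 1 / 2 := one_div_le_one_div_of_le (by norm_num) (by linarith)
    have e1 : v - (1 - 1 / (d + 1)) = b / (d + 1) := by rw [hvb]; ring
    have e2 : 2 * (1 - 1 / (d + 1)) - v = 1 - (1 + b) / (d + 1) := by rw [hvb]; ring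
    have e3 : 1 - (1 + b) / (d + 1) - (2 * M - v) = 2 * ε / (d + 1) := by rw [hvb, hMε]; ring
    have e4 : v - (2 * M - v) = 2 * (b + ε) / (d + 1) := by rw [hvb, hMε]; ring
    have h1 := le_average_of_left_of_mode hC hQ hH (c := 1 - 1 / (d + 1))
      (g := 2 * M - v) (v := v) (by push_cast; field_simp; ring) (by linarith) hg
      (by rw [← sub_pos, e1]; exact div_pos (by linarith) hN0) hv.le (by linarith)
    have h2 := hadd b ε (by linarith) hb1 hge
    rw [e1, e2, e3, h, e4] at h1
    generalize Q (1 - 1 / (d + 1)) = q₁ at h1 h2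
    generalize Q (1 - (1 + b) / (d + 1)) = q₂ at h1 h2
    field_simp at h1
    have h3 := mul_lt_mul_of_pos_right hα (show 0 < b + ε by linarith)
    linarith
  have hsa : 33 / 100 / (d + 1) < v - M := by
    rw [hvb, hMε, ← sub_pos]
    have : 0 < (ε + b - 33 / 100) / (d + 1) := div_pos (by linarith) hN0
    refine this.trans_eq ?_
    field_simp
    ring
  have havg := havg ε hε0.le hε1.le hMε rfl
  set s : ℝ := 33 / 100 / (d + 1) with hs
  have hs0 : 0 < s := by rw [hs]; positivity
  obtain ⟨ξ, hξ, hξe⟩ := exists_reflect_add_eq hH M (a := 0) (b := s) hs0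
  obtain ⟨ζ, hζ, hζe⟩ := exists_reflect_add_eq hH M hsa
  simp only [add_zero, sub_zero, sub_self] at hξe
  rw [hξe] at havg hζe
  have hlt := lt_of_mul_lt_mul_right havg hs0.le
  have hM2 : 1 / 2 ≤ M := by
    have : (1 + ε) / (d + 1 : ℝ) ≤ 1 / 2 := by
      rw [div_le_div_iff₀ hN0 (by norm_num)]
      linarith
    linarith
  have hmode : (1 : ℕ) * M ≤ d * (1 - M) := by
    push_cast
    linarith
  have hmono := monotoneOn_reflect_add_of_lt hC hQ hmode hM2 hξ.1 hξ.2 (by linarith) hlt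
  have h1 := hmono (a := s) (b := v - M) ⟨le_rfl, by linarith⟩ ⟨hsa.le, by linarith⟩ hsa.le
  have h2 := hmono (a := ζ) (b := v - M) ⟨hζ.1.le, by linarith [hζ.2]⟩
    ⟨hsa.le, by linarith⟩ hζ.2.le
  have h3 := hmono (a := v - M) (b := t) ⟨hsa.le, by linarith⟩ ⟨by linarith, ht.le⟩ hat
  simp only at h1 h2 h3
  refine le_trans ?_ h3
  rw [show M + (v - M) = v by ring, show M - (v - M) = 2 * M - v by ring] at *
  have h4 : 2 * α * (v - M) ≤ (Q (2 * M - v) + Q v) * (v - M) := by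
    have := mul_le_mul_of_nonneg_right h1 hs0.le
    have := mul_le_mul_of_nonneg_right h2 (sub_nonneg.2 hsa.le)
    linarith
  exact le_of_mul_le_mul_right h4 (by linarith)

theorem two_mul_le_reflect_add_lowerTail {d k : ℕ} (hk : 1 ≤ k) (hn : d + k < 200) {α g v : ℝ}
    (hα : α < 27 / 100) (hg : 0 ≤ g) (hgv : g < v) (hv : v < 1) {P : ℝ → ℝ}
    (hP : ∀ p, HasDerivAt P (lowerTail (d + k + 1) (d + 1) p) p)
    (h : P v - P g = α * (v - g)) (hX : k = 1 → (d + 1) * (1 - v) < 67 / 100) {t : ℝ}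
    (hat : (v - g) / 2 ≤ t) (ht : t < (g + v) / 2) (ht1 : t < 1 - (g + v) / 2) :
    2 * α ≤ lowerTail (d + k + 1) (d + 1) ((g + v) / 2 - t) +
      lowerTail (d + k + 1) (d + 1) ((g + v) / 2 + t) := by
  have hC := mode_constant_pos d k
  have hQ := hasDerivAt_lowerTail_mode d k
  by_cases hc : (g + v) / 2 ≤ 1 / 2 ∨ d * (1 - (g + v) / 2) ≤ k * ((g + v) / 2)
  · exact two_mul_le_reflect_add hC hQ (lowerTail_zero_right _ _)
      (lowerTail_one_right (by omega)) hP hgv h (by linarith) hc hat ht ht1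
  obtain ⟨hM, hc⟩ := not_or.1 hc
  rw [not_le] at hM hc
  have hk0 : (1 : ℝ) ≤ k := by exact_mod_cast hk
  have hd0 : (0 : ℝ) ≤ d := d.cast_nonneg
  have hdk : (0 : ℝ) < d + k := by linarith
  have hkd : (k : ℝ) ≤ d := by nlinarith
  have hkd' : k ≤ d := by exact_mod_cast hkd
  have hMc : (g + v) / 2 < d / (d + k) := by
    rw [lt_div_iff₀ hdk]
    linarith
  have hsmall : ¬ 27 / 100 ≤ lowerTail (d + k + 1) (d + 1) (d / (d + k)) := fun hge => by
    have := mode_lt_average hC hQ hP (c := d / (d + k)) (by field_simp; ring)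
      (by rw [div_le_div_iff₀ (by norm_num) hdk]; linarith)
      (by rw [div_le_one hdk]; linarith) hg hgv hv.le (by linarith)
    rw [h] at this
    have := lt_of_mul_lt_mul_right this (by linarith)
    linarith
  rcases hk.eq_or_lt with rfl | hk2
  · rw [Nat.cast_one] at *
    have hcd : (d : ℝ) / (d + 1) = 1 - 1 / (d + 1) := by field_simp; ring
    rcases lt_or_ge d 49 with hd | hd
    · refine absurd ?_ hsmall
      have := le_lowerTail_mode_one (N := d + 1) (by omega) (by omega)
      rw [hcd]
      exact_mod_cast this
    · exact two_mul_le_reflect_add_penultimate hd (by omega) hα hg hgv hv hP h (hX rfl)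
        (hcd ▸ hMc) hat ht1
  · exact absurd (le_lowerTail_mode hk2 (by omega) hkd') hsmall

theorem sum_range_le_of_sum_sub_le_max {n : ℕ} {u v : ℕ → ℝ} (hn : u n = v n)
    (hle : ∀ i < n, v (i + 1) ≤ u (i + 1) → u i ≤ v i)
    (hadd : ∀ i, i + 1 < n → u (i + 1) < v (i + 1) → u i + u (i + 1) ≤ v i + v (i + 1)) :
    ∑ x ∈ Finset.range (n + 1), u x ≤ ∑ x ∈ Finset.range (n + 1), v x := by
  have key : ∀ i < n, ∑ x ∈ Finset.range (i + 1), u x - ∑ x ∈ Finset.range (i + 1), v x ≤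
      max (u i - v i) 0 := by
    intro i hi
    induction i with
    | zero => simp
    | succ i ih =>
      have ih := ih (by omega)
      rw [Finset.sum_range_succ, Finset.sum_range_succ _ (i + 1)]
      rcases le_or_gt (v (i + 1)) (u (i + 1)) with h | h
      · have := hle i (by omega) h
        rw [max_eq_right (by linarith)] at ih
        exact le_max_of_le_left (by linarith)
      · have := hadd i hi h
        refine le_max_of_le_right ?_
        rcases le_total (u i - v i) 0 with h0 | h0
        · rw [max_eq_right h0] at ih
          linarith
        · rw [max_eq_left h0] at ih
          linarith
  rw [Finset.sum_range_succ, Finset.sum_range_succ _ n, hn]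
  rcases n with _ | n
  · simp
  have h1 := key n (by omega)
  have := hle n (by omega) hn.ge
  rw [max_eq_right (by linarith)] at h1
  linarith

theorem stmt_2 (n : ℕ) (hn1 : 1 ≤ n) (hn2 : n ≤ 200)
    (α : ℝ) (hα1 : (0.0001 : ℝ) < α) (hα2 : α < 0.27)
    (u v : ℕ → ℝ) (hu : IsOLCUpper n α u) (hv : IsLCCUpper n α v) :
    (∫ p in (0:ℝ)..1, ∑ x ∈ Finset.range (n + 1), u x * B n x p)
      ≤ ∫ p in (0:ℝ)..1, ∑ x ∈ Finset.range (n + 1), v x * B n x p := by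
  obtain ⟨hu0, hul, hu1, huE⟩ := hu
  obtain ⟨hv0, hvl, hv1, hvE⟩ := hv
  have hum := strictMonoOn_Iic_of_lt_succ hul
  have hvm := strictMonoOn_Iic_of_lt_succ hvl
  have hα : α < 27 / 100 := by norm_num at hα2 ⊢; exact hα2
  have hupos : ∀ i ≤ n, 0 < u i := fun i hi =>
    hu0.trans_le (hum.monotoneOn (Nat.zero_le n) hi i.zero_le)
  have hvpos : ∀ i ≤ n, 0 < v i := fun i hi =>
    hv0.trans_le (hvm.monotoneOn (Nat.zero_le n) hi i.zero_le)
  have huP : ∀ i < n, lowerTailPrimitive n (i + 1) (u (i + 1)) -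
      lowerTailPrimitive n (i + 1) (u i) = α * (u (i + 1) - u i) := fun i hi => by
    have := huE (i + 1) (by omega) hi
    rw [integral_sum_Icc_B hi, Nat.add_sub_cancel] at this
    linarith
  have hvP : ∀ i < n, lowerTailPrimitive n (i + 1) (v (i + 1)) -
      lowerTailPrimitive n (i + 1) (v i) ≤ α * (v (i + 1) - v i) := fun i hi => by
    have := hvE (i + 1) (by omega) hi
    rw [integral_sum_Icc_B hi, Nat.add_sub_cancel] at this
    linarith
  have hanti : ∀ i < n, StrictAntiOn (lowerTail n (i + 1)) (Set.Icc 0 1) := fun i hi => by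
    obtain ⟨k, rfl⟩ : ∃ k, n = i + k + 1 := ⟨n - i - 1, by omega⟩
    exact strictAntiOn_of_tail (mode_constant_pos i k) (hasDerivAt_lowerTail_mode i k)
  rw [integral_sum_mul_B, integral_sum_mul_B]
  gcongr ?_ / _
  refine sum_range_le_of_sum_sub_le_max (hu1.trans hv1.symm) (fun i hi hvu => ?_)
    fun i hi huv => ?_
  · exact left_le_left_of_right_le (hanti i hi) (hasDerivAt_lowerTailPrimitive n (i + 1))
      (hupos i hi.le) (hul i hi) (hu1 ▸ hum.monotoneOn hi Set.self_mem_Iic hi) (huP i hi)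
      (hvpos i hi.le) (hvl i hi) hvu (hvP i hi)
  · have hin : i < n := by omega
    have hu1' : u (i + 1) < 1 := hu1 ▸ hum hi.le Set.self_mem_Iic hi
    refine add_le_add_of_nested (hanti i hin) (hasDerivAt_lowerTailPrimitive n (i + 1))
      (hul i hin) (huP i hin) (hvpos i hin.le) huv (hv1 ▸
        hvm.monotoneOn hi.le Set.self_mem_Iic hi.le) (hvP i hin) fun t hat ht ht1 => ?_
    obtain ⟨k, rfl⟩ : ∃ k, n = i + k + 1 := ⟨n - i - 1, by omega⟩
    refine two_mul_le_reflect_add_lowerTail (by omega) (by omega) hα (hupos i hin.le).le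
      (hul i hin) hu1' (hasDerivAt_lowerTailPrimitive _ _) (huP i hin) ?_ hat ht ht1
    rintro rfl
    have h := huP (i + 1) hi
    rw [sub_eq_sub_of_hasDerivAt (hasDerivAt_lowerTailPrimitive _ _)
      (hasDerivAt_primitive_lowerTail_self (i + 1 + 1)), hu1] at h
    have := penultimate_endpoint (N := i + 1) (by omega) hα (hupos (i + 1) hi.le).le hu1'
    push_cast at this h
    exact this (by convert h using 4 <;> ring)
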